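/- arXiv:0812.4697 — 4 statements merged into one kernel-verified Lean document; each statement's English description precedes it below -/
import Mathlib

section
/- For every N > 0 there exist δ > 0 and ε₁ > 0 such that for every ε₀ with 0 < ε₀ ≤ ε₁ the set S_δ is contained in D_{ε₀}. -/
open scoped BigOperators

/-- `sigma' n q j z` is the function σⱼ (for 1-based `j ∈ {1,…,m}`, `m = n / q`):
`σⱼ(z) = yⱼ + ∑_{i=m+1}^{n} |z_i|² − (m+1) ∑_{i=m+(j−1)(q−1)+1}^{m+j(q−1)} |z_i|²`,
where coordinates are 1-based (coordinate `i+1` is `z i` for `i : Fin n`). -/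
noncomputable def sigma' (n q : ℕ) (j : ℕ) (z : EuclideanSpace ℂ (Fin n)) : ℝ :=
  (∑ i : Fin n, if (i : ℕ) + 1 = j then (z i).im else 0)
    + (∑ i : Fin n, if n / q + 1 ≤ (i : ℕ) + 1 then ‖z i‖ ^ 2 else 0)
    - ((n / q + 1 : ℕ) : ℝ) *
      ∑ i : Fin n,
        if n / q + (j - 1) * (q - 1) + 1 ≤ (i : ℕ) + 1 ∧ (i : ℕ) + 1 ≤ n / q + j * (q - 1)
        then ‖z i‖ ^ 2 else 0

/-- `phi n q N j z` is φⱼ for `1 ≤ j ≤ m + 1` (`m = n / q`):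
`φⱼ = σⱼ + ∑_{i=1}^{m} σᵢ² − ¼‖z‖² + N‖z‖⁴` for `j ≤ m`, and
`φ_{m+1} = −(σ₁+⋯+σ_m) + ∑_{i=1}^{m} σᵢ² − ¼‖z‖² + N‖z‖⁴`. -/
noncomputable def phi (n q : ℕ) (N : ℝ) (j : ℕ) (z : EuclideanSpace ℂ (Fin n)) : ℝ :=
  (if j = n / q + 1 then -∑ i ∈ Finset.Icc 1 (n / q), sigma' n q i z
   else sigma' n q j z)
    + ∑ i ∈ Finset.Icc 1 (n / q), sigma' n q i z ^ 2
    - (1 / 4) * ‖z‖ ^ 2 + N * ‖z‖ ^ 4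

/-- `rho n q N z = max {φⱼ(z) : 1 ≤ j ≤ m + 1}`. -/
noncomputable def rho (n q : ℕ) (N : ℝ) (z : EuclideanSpace ℂ (Fin n)) : ℝ :=
  (Finset.Icc 1 (n / q + 1)).sup'
    (Finset.nonempty_Icc.mpr (Nat.le_add_left 1 (n / q)))
    fun j => phi n q N j z

/-- `Dset n q N ε₀ = {z ∈ ℂⁿ : ρ(z) < −ε₀}`. -/
def Dset (n q : ℕ) (N ε₀ : ℝ) : Set (EuclideanSpace ℂ (Fin n)) :=
  {z | rho n q N z < -ε₀}

/-- `Sdelta n q δ` is the set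
`S_δ = {z : x₁²+⋯+x_m²+|z_{m+1}|²+⋯+|z_n|² = δ` and for each `j = 1,…,m`,
`yⱼ = −∑_{i=m+1}^{n} |z_i|² + (m+1) ∑_{i=m+(j−1)(q−1)+1}^{m+j(q−1)} |z_i|²}`. -/
def Sdelta (n q : ℕ) (δ : ℝ) : Set (EuclideanSpace ℂ (Fin n)) :=
  {z | (∑ i : Fin n, if (i : ℕ) + 1 ≤ n / q then (z i).re ^ 2 else ‖z i‖ ^ 2) = δ ∧
    ∀ j, 1 ≤ j → j ≤ n / q →
      (∑ i : Fin n, if (i : ℕ) + 1 = j then (z i).im else 0) =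
        -(∑ i : Fin n, if n / q + 1 ≤ (i : ℕ) + 1 then ‖z i‖ ^ 2 else 0)
          + ((n / q + 1 : ℕ) : ℝ) *
            ∑ i : Fin n,
              if n / q + (j - 1) * (q - 1) + 1 ≤ (i : ℕ) + 1 ∧ (i : ℕ) + 1 ≤ n / q + j * (q - 1)
              then ‖z i‖ ^ 2 else 0}

/-- The defining equations of `S_δ` say that every `σⱼ` vanishes there. -/
lemma sigma'_eq_zero_of_mem_Sdelta {n q : ℕ} {δ : ℝ} {z : EuclideanSpace ℂ (Fin n)}
    (hz : z ∈ Sdelta n q δ) {j : ℕ} (h1 : 1 ≤ j) (hj : j ≤ n / q) : sigma' n q j z = 0 := by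
  rw [sigma', hz.2 j h1 hj]
  ring

/-- On `S_δ` every `φⱼ` reduces to `−¼‖z‖² + N‖z‖⁴`. -/
lemma phi_eq_of_mem_Sdelta {n q : ℕ} {δ : ℝ} {z : EuclideanSpace ℂ (Fin n)}
    (hz : z ∈ Sdelta n q δ) (N : ℝ) {j : ℕ} (h1 : 1 ≤ j) (hj : j ≤ n / q + 1) :
    phi n q N j z = -(1 / 4) * ‖z‖ ^ 2 + N * ‖z‖ ^ 4 := by
  have hsum : ∑ i ∈ Finset.Icc 1 (n / q), sigma' n q i z = 0 :=
    Finset.sum_eq_zero fun i hi => sigma'_eq_zero_of_mem_Sdelta hz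
      (Finset.mem_Icc.mp hi).1 (Finset.mem_Icc.mp hi).2
  have hsq : ∑ i ∈ Finset.Icc 1 (n / q), sigma' n q i z ^ 2 = 0 :=
    Finset.sum_eq_zero fun i hi => by
      rw [sigma'_eq_zero_of_mem_Sdelta hz (Finset.mem_Icc.mp hi).1 (Finset.mem_Icc.mp hi).2]
      norm_num
  have hhead : (if j = n / q + 1 then -∑ i ∈ Finset.Icc 1 (n / q), sigma' n q i z
      else sigma' n q j z) = 0 := by
    split_ifs with h
    · rw [hsum, neg_zero]
    · exact sigma'_eq_zero_of_mem_Sdelta hz h1 (by omega)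
  rw [phi, hhead, hsq]
  ring

lemma Complex.norm_sq_eq_re_sq_add_im_sq (w : ℂ) : ‖w‖ ^ 2 = w.re ^ 2 + w.im ^ 2 := by
  rw [Complex.sq_norm, Complex.normSq_apply]
  ring

lemma le_norm_sq_of_mem_Sdelta {n q : ℕ} {δ : ℝ} {z : EuclideanSpace ℂ (Fin n)}
    (hz : z ∈ Sdelta n q δ) : δ ≤ ‖z‖ ^ 2 := by
  rw [← hz.1, EuclideanSpace.norm_sq_eq]
  refine Finset.sum_le_sum fun i _ => ?_
  split_ifs
  · rw [Complex.norm_sq_eq_re_sq_add_im_sq]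
    nlinarith [sq_nonneg (z i).im]
  · rfl

/-- A sum of `|z_i|²` over indices beyond `m` is at most `δ` on `S_δ`. -/
lemma sum_norm_sq_le_of_mem_Sdelta {n q : ℕ} {δ : ℝ} {z : EuclideanSpace ℂ (Fin n)}
    (hz : z ∈ Sdelta n q δ) (p : Fin n → Prop) [DecidablePred p]
    (hp : ∀ i, p i → n / q + 1 ≤ (i : ℕ) + 1) :
    (∑ i : Fin n, if p i then ‖z i‖ ^ 2 else 0) ≤ δ := by
  rw [← hz.1]
  refine Finset.sum_le_sum fun i _ => ?_
  by_cases h : p i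
  · rw [if_pos h, if_neg (by have := hp i h; omega)]
  · rw [if_neg h]
    split_ifs <;> positivity

lemma im_sq_le_of_mem_Sdelta {n q : ℕ} {δ : ℝ} {z : EuclideanSpace ℂ (Fin n)}
    (hz : z ∈ Sdelta n q δ) {i : Fin n} (hi : (i : ℕ) + 1 ≤ n / q) :
    (z i).im ^ 2 ≤ (((n / q + 1 : ℕ) : ℝ) * δ) ^ 2 := by
  have him := hz.2 (i + 1) (by omega) hi
  have hsingle : (∑ k : Fin n, if (k : ℕ) + 1 = i + 1 then (z k).im else 0) = (z i).im := by
    rw [Finset.sum_eq_single i]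
    · simp
    · intro k _ hk
      rw [if_neg fun h => hk (Fin.ext (by omega))]
    · simp
  rw [hsingle] at him
  have hA := sum_norm_sq_le_of_mem_Sdelta hz
    (fun k : Fin n => n / q + 1 ≤ (k : ℕ) + 1) fun _ h => h
  have hB := sum_norm_sq_le_of_mem_Sdelta hz
    (fun k : Fin n => n / q + ((i : ℕ) + 1 - 1) * (q - 1) + 1 ≤ (k : ℕ) + 1 ∧
      (k : ℕ) + 1 ≤ n / q + ((i : ℕ) + 1) * (q - 1))
    fun k h => le_trans (by gcongr; exact Nat.le_add_right _ _) h.1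
  have hA0 : 0 ≤ ∑ k : Fin n, if n / q + 1 ≤ (k : ℕ) + 1 then ‖z k‖ ^ 2 else 0 :=
    Finset.sum_nonneg fun k _ => by split_ifs <;> positivity
  have hB0 : 0 ≤ ∑ k : Fin n,
      if n / q + ((i : ℕ) + 1 - 1) * (q - 1) + 1 ≤ (k : ℕ) + 1 ∧
        (k : ℕ) + 1 ≤ n / q + ((i : ℕ) + 1) * (q - 1) then ‖z k‖ ^ 2 else 0 :=
    Finset.sum_nonneg fun k _ => by split_ifs <;> positivity
  have hM : (1 : ℝ) ≤ ((n / q + 1 : ℕ) : ℝ) := by exact_mod_cast Nat.le_add_left 1 (n / q)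
  generalize ((n / q + 1 : ℕ) : ℝ) = M at *
  rw [him]
  refine sq_le_sq' ?_ ?_ <;> nlinarith

lemma norm_sq_le_of_mem_Sdelta {n q : ℕ} {δ : ℝ} {z : EuclideanSpace ℂ (Fin n)}
    (hz : z ∈ Sdelta n q δ) : ‖z‖ ^ 2 ≤ δ + n * (((n / q + 1 : ℕ) : ℝ) * δ) ^ 2 := by
  have hterm : ∀ i : Fin n, ‖z i‖ ^ 2 ≤
      (if (i : ℕ) + 1 ≤ n / q then (z i).re ^ 2 else ‖z i‖ ^ 2)
        + (((n / q + 1 : ℕ) : ℝ) * δ) ^ 2 := by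
    intro i
    split_ifs with h
    · rw [Complex.norm_sq_eq_re_sq_add_im_sq]
      exact add_le_add_right (im_sq_le_of_mem_Sdelta hz h) _
    · exact le_add_of_nonneg_right (sq_nonneg _)
  calc ‖z‖ ^ 2 = ∑ i, ‖z i‖ ^ 2 := EuclideanSpace.norm_sq_eq z
    _ ≤ _ := Finset.sum_le_sum fun i _ => hterm i
    _ = _ := by rw [Finset.sum_add_distrib, hz.1]; simp

/-- for every N > 0 there exist δ > 0 and ε₁ > 0 such that for every ε₀ with
0 < ε₀ ≤ ε₁ the set S_δ is contained in D_{ε₀}. -/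
theorem stmt3 (n q : ℕ) (hn : 4 ≤ n) (hq1 : 1 ≤ q) (hqn : q ≤ n) (hdvd : ¬ q ∣ n) :
    ∀ N : ℝ, 0 < N → ∃ δ > (0 : ℝ), ∃ ε₁ > (0 : ℝ),
      ∀ ε₀ : ℝ, 0 < ε₀ → ε₀ ≤ ε₁ → Sdelta n q δ ⊆ Dset n q N ε₀ := by
  intro N hN
  set C : ℝ := 1 + n * ((n / q + 1 : ℕ) : ℝ) ^ 2 with hC
  have hCpos : 0 < C := by positivity
  have hδ : 0 < 1 / (8 * N * C + 1) := by positivity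
  have hδ1 : 1 / (8 * N * C + 1) ≤ 1 := by
    rw [div_le_one (by positivity)]
    have : 0 < 8 * N * C := by positivity
    linarith
  have hδC : 8 * N * C * (1 / (8 * N * C + 1)) ≤ 1 := by
    rw [mul_one_div, div_le_one (by positivity)]
    linarith
  generalize 1 / (8 * N * C + 1) = δ at hδ hδ1 hδC
  refine ⟨δ, hδ, δ / 16, by positivity, fun ε₀ _ hε z hz => ?_⟩
  change rho n q N z < -ε₀
  rw [rho, Finset.sup'_lt_iff]
  intro j hj
  rw [phi_eq_of_mem_Sdelta hz N (Finset.mem_Icc.mp hj).1 (Finset.mem_Icc.mp hj).2]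
  have hlow := le_norm_sq_of_mem_Sdelta hz
  have hup : ‖z‖ ^ 2 ≤ C * δ := by
    refine (norm_sq_le_of_mem_Sdelta hz).trans ?_
    have hsq : δ ^ 2 ≤ δ := by nlinarith
    rw [mul_pow, hC, add_mul, one_mul, mul_assoc]
    gcongr
  have hNr : N * ‖z‖ ^ 2 ≤ 1 / 8 := by
    have := mul_le_mul_of_nonneg_left hup hN.le
    nlinarith
  have hquart : N * ‖z‖ ^ 4 ≤ 1 / 8 * ‖z‖ ^ 2 := by
    have := mul_le_mul_of_nonneg_right hNr (sq_nonneg ‖z‖)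
    linarith [show N * ‖z‖ ^ 4 = N * ‖z‖ ^ 2 * ‖z‖ ^ 2 by ring]
  linarith
end

section
/- For every z in the real-linear subspace E = {z ∈ ℂⁿ : x₁ = ⋯ = x_m = 0 and z_{m+1} = ⋯ = zₙ = 0} one has ρ(z) ≥ 0; consequently D_{ε₀} ∩ E = ∅ for every ε₀ > 0. -/
open scoped BigOperators

/-- Where the last `n - m` coordinates vanish, `σⱼ` reduces to `yⱼ`. -/
theorem sigma'_eq_im {n q : ℕ} {z : EuclideanSpace ℂ (Fin n)}
    (hz : ∀ i : Fin n, n / q + 1 ≤ (i : ℕ) + 1 → z i = 0) (i : Fin n) :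
    sigma' n q ((i : ℕ) + 1) z = (z i).im := by
  have him : (∑ k : Fin n, if (k : ℕ) + 1 = (i : ℕ) + 1 then (z k).im else 0) = (z i).im := by
    simp [Fin.val_inj]
  have htail : (∑ k : Fin n, if n / q + 1 ≤ (k : ℕ) + 1 then ‖z k‖ ^ 2 else 0) = 0 :=
    Finset.sum_eq_zero fun k _ => by
      split_ifs with h
      · simp [hz k h]
      · rfl
  have hblock : (∑ k : Fin n,
      if n / q + ((i : ℕ) + 1 - 1) * (q - 1) + 1 ≤ (k : ℕ) + 1 ∧
        (k : ℕ) + 1 ≤ n / q + ((i : ℕ) + 1) * (q - 1)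
      then ‖z k‖ ^ 2 else 0) = 0 :=
    Finset.sum_eq_zero fun k _ => by
      split_ifs with h
      · simp [hz k (le_trans (by gcongr; exact Nat.le_add_right _ _) h.1)]
      · rfl
  rw [sigma', him, htail, hblock]
  ring

/-- On the subspace `E`, the squares of the `σⱼ` sum to `‖z‖²`. -/
theorem sum_sigma'_sq {n q : ℕ} {z : EuclideanSpace ℂ (Fin n)}
    (hz : ∀ i : Fin n, ((i : ℕ) + 1 ≤ n / q → (z i).re = 0) ∧
      (n / q + 1 ≤ (i : ℕ) + 1 → z i = 0)) :
    ∑ j ∈ Finset.Icc 1 (n / q), sigma' n q j z ^ 2 = ‖z‖ ^ 2 := by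
  rw [EuclideanSpace.norm_sq_eq]
  symm
  refine Finset.sum_bij_ne_zero (fun i _ _ => (i : ℕ) + 1) ?_ ?_ ?_ ?_
  · intro i _ hi
    rw [Finset.mem_Icc]
    refine ⟨Nat.le_add_left _ _, ?_⟩
    by_contra h
    exact hi (by simp [(hz i).2 (by omega)])
  · intro i _ _ k _ _ h
    exact Fin.ext (Nat.succ_injective h)
  · intro j hj hne
    rw [Finset.mem_Icc] at hj
    have hjn : j - 1 < n := by
      have := Nat.div_le_self n q
      omega
    have hsucc : j - 1 + 1 = j := Nat.sub_add_cancel hj.1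
    have him := sigma'_eq_im (q := q) (fun i => (hz i).2) ⟨j - 1, hjn⟩
    simp only [hsucc] at him
    refine ⟨⟨j - 1, hjn⟩, Finset.mem_univ _, ?_, hsucc⟩
    intro h
    apply hne
    rw [him, show z ⟨j - 1, hjn⟩ = 0 by simpa using h]
    simp
  · intro i _ hi
    have hre : (z i).re = 0 := by
      rcases le_or_gt ((i : ℕ) + 1) (n / q) with h | h
      · exact (hz i).1 h
      · simp [(hz i).2 (by omega)]
    rw [sigma'_eq_im fun i => (hz i).2, Complex.sq_norm, Complex.normSq_apply, hre]
    ring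

/-- `ρ` is nonnegative wherever `∑ σⱼ² ≥ ¼‖z‖²`: the linear terms of the `φⱼ` sum to zero,
so they cannot all be negative. -/
theorem rho_nonneg {n q : ℕ} {N : ℝ} (hN : 0 ≤ N) {z : EuclideanSpace ℂ (Fin n)}
    (hz : (1 / 4) * ‖z‖ ^ 2 ≤ ∑ j ∈ Finset.Icc 1 (n / q), sigma' n q j z ^ 2) :
    0 ≤ rho n q N z := by
  have hquartic : 0 ≤ N * ‖z‖ ^ 4 := by positivity
  rw [rho, Finset.le_sup'_iff]
  by_cases h : ∃ j ∈ Finset.Icc 1 (n / q), 0 ≤ sigma' n q j z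
  · obtain ⟨j, hj, hσ⟩ := h
    rw [Finset.mem_Icc] at hj
    refine ⟨j, Finset.mem_Icc.mpr ⟨hj.1, by omega⟩, ?_⟩
    rw [phi, if_neg (by omega)]
    linarith
  · push Not at h
    refine ⟨n / q + 1, Finset.mem_Icc.mpr ⟨Nat.le_add_left _ _, le_rfl⟩, ?_⟩
    have hsum := Finset.sum_nonpos fun j hj => (h j hj).le
    rw [phi, if_pos rfl]
    linarith

/-- on the real-linear subspace
E = {z : x₁ = ⋯ = x_m = 0, z_{m+1} = ⋯ = zₙ = 0} one has ρ ≥ 0; consequently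
D_{ε₀} ∩ E = ∅ for every ε₀ > 0. -/
theorem stmt4 (n q : ℕ) (hn : 4 ≤ n) (hq1 : 1 ≤ q) (hqn : q ≤ n) (hdvd : ¬ q ∣ n)
    (N : ℝ) (hN : 0 < N) :
    (∀ z : EuclideanSpace ℂ (Fin n),
      (∀ i : Fin n, ((i : ℕ) + 1 ≤ n / q → (z i).re = 0) ∧
        (n / q + 1 ≤ (i : ℕ) + 1 → z i = 0)) →
      0 ≤ rho n q N z) ∧
    ∀ ε₀ : ℝ, 0 < ε₀ →
      Dset n q N ε₀ ∩
        {z : EuclideanSpace ℂ (Fin n) |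
          ∀ i : Fin n, ((i : ℕ) + 1 ≤ n / q → (z i).re = 0) ∧
            (n / q + 1 ≤ (i : ℕ) + 1 → z i = 0)} = ∅ := by
  have hρ : ∀ z : EuclideanSpace ℂ (Fin n),
      (∀ i : Fin n, ((i : ℕ) + 1 ≤ n / q → (z i).re = 0) ∧
        (n / q + 1 ≤ (i : ℕ) + 1 → z i = 0)) → 0 ≤ rho n q N z := by
    intro z hz
    apply rho_nonneg hN.le
    rw [sum_sigma'_sq hz]
    linarith [sq_nonneg ‖z‖]
  refine ⟨hρ, fun ε₀ hε => Set.eq_empty_iff_forall_notMem.mpr ?_⟩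
  rintro z ⟨hD, hE⟩
  have hlt : rho n q N z < -ε₀ := hD
  linarith [hρ z hE]
end

section
/- For every δ > 0 the set S_δ, equipped with the subspace topology from ℂⁿ, is homeomorphic to the unit sphere S^{2n−m−1} in ℝ^{2n−m}; in particular S_δ is a compact topological sphere of real dimension 2n−m−1. -/
open scoped BigOperators

/-- The graph, over the sphere `∑_{i<m} xᵢ² + ∑_{i≥m} |zᵢ|² = δ`, of the imaginary parts of the
first `m` coordinates as functions `G i` of `z`. -/
def graphSphere (n m : ℕ) (G : Fin n → EuclideanSpace ℂ (Fin n) → ℝ) (δ : ℝ) :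
    Set (EuclideanSpace ℂ (Fin n)) :=
  {z | (∑ i : Fin n, if (i : ℕ) + 1 ≤ m then (z i).re ^ 2 else ‖z i‖ ^ 2) = δ ∧
    ∀ i : Fin n, (i : ℕ) < m → (z i).im = G i z}

/-- The real coordinates which parametrize a graph over the sphere: all real parts, and the
imaginary parts of the coordinates of index at least `m`. -/
abbrev GraphCoord (n m : ℕ) : Type := Fin n ⊕ {i : Fin n // m ≤ (i : ℕ)}

theorem card_graphCoord {n m : ℕ} (hm : m ≤ n) : Fintype.card (GraphCoord n m) = 2 * n - m := by
  have h := Fintype.card_subtype_compl (fun i : Fin n => (i : ℕ) < m)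
  have h2 : Fintype.card {i : Fin n // (i : ℕ) < m} = min n m := by
    rw [Fintype.card_subtype]
    exact Fin.card_filter_val_lt
  have h3 : Fintype.card {i : Fin n // m ≤ (i : ℕ)}
      = Fintype.card {i : Fin n // ¬ (i : ℕ) < m} :=
    Fintype.card_congr (Equiv.subtypeEquivRight fun i => not_lt.symm)
  rw [Fintype.card_sum, Fintype.card_fin, h3, h, h2, Fintype.card_fin]
  omega

/-- The point of `ℂⁿ` with given parametrizing coordinates whose remaining imaginary parts
vanish. -/
noncomputable def graphBase (n m : ℕ) (w : EuclideanSpace ℝ (GraphCoord n m)) :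
    EuclideanSpace ℂ (Fin n) :=
  WithLp.toLp 2 fun i =>
    ((w (Sum.inl i) : ℝ) : ℂ) +
      ((if h : m ≤ (i : ℕ) then w (Sum.inr ⟨i, h⟩) else 0 : ℝ) : ℂ) * Complex.I

/-- The point of the graph of `G` with given parametrizing coordinates. -/
noncomputable def graphPoint (n m : ℕ) (G : Fin n → EuclideanSpace ℂ (Fin n) → ℝ)
    (w : EuclideanSpace ℝ (GraphCoord n m)) : EuclideanSpace ℂ (Fin n) :=
  WithLp.toLp 2 fun i =>
    ((w (Sum.inl i) : ℝ) : ℂ) +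
      ((if h : m ≤ (i : ℕ) then w (Sum.inr ⟨i, h⟩) else G i (graphBase n m w) : ℝ) : ℂ) *
        Complex.I

/-- The parametrizing coordinates of a point of `ℂⁿ`. -/
noncomputable def graphProj (n m : ℕ) (z : EuclideanSpace ℂ (Fin n)) :
    EuclideanSpace ℝ (GraphCoord n m) :=
  WithLp.toLp 2 (Sum.elim (fun i => (z i).re) fun i => (z i).im)

theorem continuous_graphProj (n m : ℕ) : Continuous (graphProj n m) := by
  refine (PiLp.continuous_toLp 2 _).comp (continuous_pi ?_)
  rintro (i | i)
  · exact Complex.continuous_re.comp (PiLp.continuous_apply 2 _ i)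
  · exact Complex.continuous_im.comp (PiLp.continuous_apply 2 _ _)

@[fun_prop]
theorem continuous_graphBase (n m : ℕ) : Continuous (graphBase n m) := by
  refine (PiLp.continuous_toLp 2 _).comp (continuous_pi fun i => ?_)
  by_cases h : m ≤ (i : ℕ) <;> simp only [h, dite_true, dite_false] <;> fun_prop

theorem continuous_graphPoint (n m : ℕ) {G : Fin n → EuclideanSpace ℂ (Fin n) → ℝ}
    (hG : ∀ i, Continuous (G i)) : Continuous (graphPoint n m G) := by
  refine (PiLp.continuous_toLp 2 _).comp (continuous_pi fun i => ?_)
  by_cases h : m ≤ (i : ℕ) <;> simp only [h, dite_true, dite_false] <;> fun_prop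

theorem graphProj_graphPoint (n m : ℕ) (G : Fin n → EuclideanSpace ℂ (Fin n) → ℝ)
    (w : EuclideanSpace ℝ (GraphCoord n m)) : graphProj n m (graphPoint n m G w) = w := by
  ext k
  rcases k with i | ⟨i, hi⟩
  · simp [graphProj, graphPoint]
  · simp [graphProj, graphPoint, hi]

theorem norm_sq_graphProj (n m : ℕ) (z : EuclideanSpace ℂ (Fin n)) :
    ‖graphProj n m z‖ ^ 2 =
      ∑ i : Fin n, if (i : ℕ) + 1 ≤ m then (z i).re ^ 2 else ‖z i‖ ^ 2 := by
  rw [EuclideanSpace.norm_sq_eq, Fintype.sum_sum_type]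
  have h : ∑ i : {i : Fin n // m ≤ (i : ℕ)}, (z i).im ^ 2
      = ∑ i : Fin n, if m ≤ (i : ℕ) then (z i).im ^ 2 else 0 := by
    rw [← Finset.sum_filter]
    exact (Finset.sum_subtype _ (by simp) fun i : Fin n => (z i).im ^ 2).symm
  simp only [graphProj, Sum.elim_inl, Sum.elim_inr, Real.norm_eq_abs, sq_abs]
  rw [h, ← Finset.sum_add_distrib]
  refine Finset.sum_congr rfl fun i _ => ?_
  by_cases hi : m ≤ (i : ℕ)
  · rw [if_pos hi, if_neg (by omega), Complex.sq_norm, Complex.normSq_apply]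
    ring
  · rw [if_neg hi, if_pos (by omega), add_zero]

/-- A graph over a sphere is homeomorphic to the unit sphere, provided that the graph functions
are continuous and depend only on the coordinates of index at least `m`. -/
theorem nonempty_graphSphere_homeomorph {n m : ℕ} (hm : m ≤ n)
    {G : Fin n → EuclideanSpace ℂ (Fin n) → ℝ} (hG : ∀ i, Continuous (G i))
    (hloc : ∀ i z w, (∀ k : Fin n, m ≤ (k : ℕ) → z k = w k) → G i z = G i w)
    {δ : ℝ} (hδ : 0 < δ) :
    Nonempty (graphSphere n m G δ ≃ₜ
      Metric.sphere (0 : EuclideanSpace ℝ (Fin (2 * n - m))) 1) := by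
  have hr : 0 < √δ := Real.sqrt_pos.2 hδ
  have hbase : ∀ w i, G i (graphBase n m w) = G i (graphPoint n m G w) := fun w i =>
    hloc i _ _ fun k hk => by simp [graphBase, graphPoint, hk]
  have hleft : ∀ z ∈ graphSphere n m G δ, graphPoint n m G (graphProj n m z) = z := by
    intro z hz
    ext i
    by_cases hi : m ≤ (i : ℕ)
    · apply Complex.ext <;> simp [graphProj, graphPoint, hi]
    · have hb : G i (graphBase n m (graphProj n m z)) = G i z :=
        hloc i _ _ fun k hk => by
          apply Complex.ext <;> simp [graphBase, graphProj, hk]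
      have hz2 := hz.2 i (by omega)
      apply Complex.ext
      · simp [graphProj, graphPoint]
      · simp [graphPoint, hi, hb, hz2]
  let e : GraphCoord n m ≃ Fin (2 * n - m) := Fintype.equivFinOfCardEq (card_graphCoord hm)
  let L : EuclideanSpace ℝ (GraphCoord n m) ≃ₗᵢ[ℝ] EuclideanSpace ℝ (Fin (2 * n - m)) :=
    LinearIsometryEquiv.piLpCongrLeft 2 ℝ ℝ e
  refine ⟨{
    toFun := fun z => ⟨(√δ)⁻¹ • L (graphProj n m z), ?_⟩
    invFun := fun w => ⟨graphPoint n m G (L.symm (√δ • (w : EuclideanSpace ℝ _))), ?_, ?_⟩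
    left_inv := ?_
    right_inv := ?_
    continuous_toFun := ?_
    continuous_invFun := ?_ }⟩
  · have h : ‖graphProj n m z‖ = √δ := by
      rw [← Real.sqrt_sq (norm_nonneg (graphProj n m z)), norm_sq_graphProj, z.2.1]
    rw [mem_sphere_zero_iff_norm, norm_smul, L.norm_map, h, norm_inv, Real.norm_of_nonneg hr.le,
      inv_mul_cancel₀ hr.ne']
  · rw [← norm_sq_graphProj, graphProj_graphPoint, L.symm.norm_map, norm_smul,
      mem_sphere_zero_iff_norm.1 w.2, mul_one, Real.norm_of_nonneg hr.le, Real.sq_sqrt hδ.le]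
  · intro i hi
    rw [← hbase]
    simp [graphPoint, not_le.2 hi]
  · intro z
    apply Subtype.ext
    simp only [smul_smul, mul_inv_cancel₀ hr.ne', one_smul, LinearIsometryEquiv.symm_apply_apply]
    exact hleft z z.2
  · intro w
    apply Subtype.ext
    simp only [graphProj_graphPoint, LinearIsometryEquiv.apply_symm_apply, smul_smul,
      inv_mul_cancel₀ hr.ne', one_smul]
  · have h : Continuous fun z => (√δ)⁻¹ • L (graphProj n m z) :=
      (L.continuous.comp (continuous_graphProj n m)).const_smul (√δ)⁻¹
    exact (h.comp continuous_subtype_val).subtype_mk _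
  · have h : Continuous fun w => graphPoint n m G (L.symm (√δ • w)) :=
      (continuous_graphPoint n m hG).comp (L.symm.continuous.comp (continuous_const_smul √δ))
    exact (h.comp continuous_subtype_val).subtype_mk _

/-- The value prescribed for `y_{i+1}` on `Sdelta n q δ`. -/
noncomputable def prescribedIm (n q : ℕ) (i : Fin n) (z : EuclideanSpace ℂ (Fin n)) : ℝ :=
  -(∑ k : Fin n, if n / q + 1 ≤ (k : ℕ) + 1 then ‖z k‖ ^ 2 else 0)
    + ((n / q + 1 : ℕ) : ℝ) *
      ∑ k : Fin n,
        if n / q + ((i : ℕ) + 1 - 1) * (q - 1) + 1 ≤ (k : ℕ) + 1 ∧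
          (k : ℕ) + 1 ≤ n / q + ((i : ℕ) + 1) * (q - 1)
        then ‖z k‖ ^ 2 else 0

theorem continuous_prescribedIm (n q : ℕ) (i : Fin n) : Continuous (prescribedIm n q i) := by
  have h : ∀ (p : Fin n → Prop) [DecidablePred p],
      Continuous fun z : EuclideanSpace ℂ (Fin n) => ∑ k, if p k then ‖z k‖ ^ 2 else 0 := by
    intro p _
    refine continuous_finsetSum _ fun k _ => ?_
    by_cases hk : p k <;> simp only [hk, if_true, if_false] <;> fun_prop
  exact (h _).neg.add (continuous_const.mul (h _))

theorem prescribedIm_congr (n q : ℕ) (i : Fin n) (z w : EuclideanSpace ℂ (Fin n))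
    (h : ∀ k : Fin n, n / q ≤ (k : ℕ) → z k = w k) :
    prescribedIm n q i z = prescribedIm n q i w := by
  have hsum : ∀ (p : Fin n → Prop) [DecidablePred p], (∀ k, p k → n / q ≤ (k : ℕ)) →
      (∑ k, if p k then ‖z k‖ ^ 2 else 0) = ∑ k, if p k then ‖w k‖ ^ 2 else 0 := by
    intro p _ hp
    refine Finset.sum_congr rfl fun k _ => ?_
    split_ifs with hk
    · rw [h k (hp k hk)]
    · rfl
  unfold prescribedIm
  rw [hsum (fun k => n / q + 1 ≤ (k : ℕ) + 1) fun k hk => by omega,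
    hsum (fun k => n / q + ((i : ℕ) + 1 - 1) * (q - 1) + 1 ≤ (k : ℕ) + 1 ∧
      (k : ℕ) + 1 ≤ n / q + ((i : ℕ) + 1) * (q - 1)) fun k hk => by
        have := Nat.le_add_right (n / q) (((i : ℕ) + 1 - 1) * (q - 1))
        omega]

theorem Sdelta_eq_graphSphere (n q : ℕ) (δ : ℝ) :
    Sdelta n q δ = graphSphere n (n / q) (prescribedIm n q) δ := by
  have him : ∀ (z : EuclideanSpace ℂ (Fin n)) (i : Fin n),
      (∑ k : Fin n, if (k : ℕ) + 1 = (i : ℕ) + 1 then (z k).im else 0) = (z i).im := by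
    intro z i
    simp [← Fin.ext_iff]
  ext z
  refine and_congr_right fun _ => ⟨fun h i hi => ?_, fun h j hj1 hj => ?_⟩
  · rw [← him z i]
    exact h (i + 1) (by omega) hi
  · obtain ⟨i, rfl⟩ := Nat.exists_eq_add_of_le' hj1
    have hin : i < n := lt_of_lt_of_le hj (Nat.div_le_self n q)
    exact (him z ⟨i, hin⟩).trans (h ⟨i, hin⟩ hj)

/-- for every δ > 0 the set S_δ, with the subspace topology from ℂⁿ, is
homeomorphic to the unit sphere S^{2n−m−1} ⊆ ℝ^{2n−m}; in particular S_δ is compact. -/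
theorem stmt5 (n q : ℕ) (hn : 4 ≤ n) (hq1 : 1 ≤ q) (hqn : q ≤ n) (hdvd : ¬ q ∣ n) :
    ∀ δ : ℝ, 0 < δ →
      Nonempty
        ((Sdelta n q δ) ≃ₜ
          (Metric.sphere (0 : EuclideanSpace ℝ (Fin (2 * n - n / q))) 1)) ∧
      IsCompact (Sdelta n q δ) := by
  intro δ hδ
  rw [Sdelta_eq_graphSphere]
  obtain ⟨e⟩ := nonempty_graphSphere_homeomorph (Nat.div_le_self n q) (continuous_prescribedIm n q)
    (prescribedIm_congr n q) hδ
  have : CompactSpace (graphSphere n (n / q) (prescribedIm n q) δ) := e.symm.compactSpace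
  exact ⟨⟨e⟩, isCompact_iff_compactSpace.2 inferInstance⟩
end

section
/- There exists N₀ > 0 such that for every N ≥ N₀ and every j ∈ {1,…,m+1} the function φⱼ is q-convex on ℂⁿ in the following sense: for every z ∈ ℂⁿ there exists a complex-linear subspace V of ℂⁿ with dim_ℂ V ≥ n − q + 1 such that for every nonzero w ∈ V the Levi form of φⱼ at z is positive on w, i.e. D²φⱼ(z)(w, w) + D²φⱼ(z)(i·w, i·w) > 0, where D²φⱼ(z) denotes the second Fréchet derivative of φⱼ (as a smooth function of the underlying real variables) at z and i·w is the multiplication of w by the imaginary unit. -/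
open scoped BigOperators

open Finset

section SecondDerivative

variable {E : Type*} [NormedAddCommGroup E] [NormedSpace ℝ E]

/-- The second derivative of `f` in the direction `w` is twice the quadratic coefficient of `f`
along the line through `z` with direction `w`. -/
theorem iteratedFDeriv_two_eq_of_line_eq {f : E → ℝ} (hf : ContDiff ℝ 2 f) {z w : E}
    {a₀ a₁ a₂ a₃ a₄ : ℝ}
    (h : ∀ t : ℝ, f (z + t • w) = a₀ + a₁ * t + a₂ * t ^ 2 + a₃ * t ^ 3 + a₄ * t ^ 4) :
    iteratedFDeriv ℝ 2 f z ![w, w] = 2 * a₂ := by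
  rw [iteratedFDeriv_two_apply]
  simp only [Matrix.cons_val_zero, Matrix.cons_val_one]
  have hline : ∀ t : ℝ, HasDerivAt (fun t : ℝ => z + t • w) w t := fun t => by
    simpa using ((hasDerivAt_id t).smul_const w).const_add z
  have hfirst : ∀ t : ℝ,
      fderiv ℝ f (z + t • w) w = a₁ + 2 * a₂ * t + 3 * a₃ * t ^ 2 + 4 * a₄ * t ^ 3 := fun t => by
    have hchain := ((hf.differentiable (by norm_num)) (z + t • w)).hasFDerivAt.comp_hasDerivAt t
      (hline t)
    have hpoly : HasDerivAt (fun t : ℝ => a₀ + a₁ * t + a₂ * t ^ 2 + a₃ * t ^ 3 + a₄ * t ^ 4)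
        (a₁ + 2 * a₂ * t + 3 * a₃ * t ^ 2 + 4 * a₄ * t ^ 3) t := by
      have hid := hasDerivAt_id' t
      exact (((((hid.const_mul a₁).const_add a₀).add ((hid.pow 2).const_mul a₂)).add
        ((hid.pow 3).const_mul a₃)).add ((hid.pow 4).const_mul a₄)).congr_deriv
        (by norm_num; ring)
    refine hchain.unique (hpoly.congr_of_eventuallyEq (Filter.Eventually.of_forall fun s => ?_))
    exact h s
  have hdiff : Differentiable ℝ (fderiv ℝ f) :=
    (hf.fderiv_right (m := 1) (by norm_num)).differentiable (by norm_num)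
  have hchain : HasDerivAt (fun t : ℝ => fderiv ℝ f (z + t • w) w)
      (fderiv ℝ (fderiv ℝ f) z w w) 0 := by
    have hz : z + (0 : ℝ) • w = z := by simp
    have hcomp : HasDerivAt (fun t : ℝ => fderiv ℝ f (z + t • w))
        (fderiv ℝ (fderiv ℝ f) (z + (0 : ℝ) • w) w) 0 :=
      (hdiff (z + (0 : ℝ) • w)).hasFDerivAt.comp_hasDerivAt (0 : ℝ) (hline 0)
    rw [hz] at hcomp
    simpa using hcomp.clm_apply (hasDerivAt_const (0 : ℝ) w)
  have hpoly : HasDerivAt (fun t : ℝ => a₁ + 2 * a₂ * t + 3 * a₃ * t ^ 2 + 4 * a₄ * t ^ 3)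
      (2 * a₂) 0 := by
    have hid := hasDerivAt_id' (0 : ℝ)
    exact ((((hid.const_mul (2 * a₂)).const_add a₁).add ((hid.pow 2).const_mul (3 * a₃))).add
      ((hid.pow 3).const_mul (4 * a₄))).congr_deriv (by norm_num)
  exact hchain.unique (hpoly.congr_of_eventuallyEq (Filter.Eventually.of_forall hfirst))

end SecondDerivative

/-- The vectors whose coordinates with index in `[a, a + l)` vanish. -/
def vanishingOn (n a l : ℕ) : Submodule ℂ (EuclideanSpace ℂ (Fin n)) where
  carrier := {w | ∀ i : Fin n, a ≤ (i : ℕ) → (i : ℕ) < a + l → w i = 0}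
  zero_mem' := fun i _ _ => rfl
  add_mem' := fun hv hw i h₁ h₂ => by simp [hv i h₁ h₂, hw i h₁ h₂]
  smul_mem' := fun c w hw i h₁ h₂ => by simp [hw i h₁ h₂]

theorem le_finrank_vanishingOn (n a l : ℕ) :
    n ≤ Module.finrank ℂ (vanishingOn n a l) + l := by
  let S : Finset (Fin n) := univ.filter fun i => a ≤ (i : ℕ) ∧ (i : ℕ) < a + l
  have hS : S.card ≤ l := by
    have := card_le_card_of_injOn (s := S) (t := Finset.Ico a (a + l)) (fun i => (i : ℕ))
      (fun i hi => by simpa [S] using hi) (Fin.val_injective.injOn)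
    simpa using this
  let F : EuclideanSpace ℂ (Fin n) →ₗ[ℂ] (S → ℂ) :=
    LinearMap.pi fun i => (EuclideanSpace.proj (i : Fin n) : EuclideanSpace ℂ (Fin n) →L[ℂ] ℂ)
  have hker : vanishingOn n a l = LinearMap.ker F := by
    ext w
    have : w ∈ vanishingOn n a l ↔ ∀ i : Fin n, a ≤ (i : ℕ) → (i : ℕ) < a + l → w i = 0 := Iff.rfl
    simp [this, F, funext_iff, S]
  have hrank := F.finrank_range_add_finrank_ker
  have hrange := F.range.finrank_le
  simp only [finrank_euclideanSpace, Fintype.card_fin, Module.finrank_fintype_fun_eq_card,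
    Fintype.card_coe] at hrank hrange
  rw [hker]
  omega

section

variable {n : ℕ}

/-- The imaginary part of the coordinate with one-based index `j`. -/
noncomputable def imCoord (j : ℕ) (w : EuclideanSpace ℂ (Fin n)) : ℝ :=
  ∑ i : Fin n, if (i : ℕ) + 1 = j then (w i).im else 0

/-- The coefficient of `‖z i‖ ^ 2` in `sigma' n q j z`. -/
noncomputable def quadCoeff (n q j : ℕ) (i : Fin n) : ℝ :=
  (if n / q + 1 ≤ (i : ℕ) + 1 then 1 else 0) - ((n / q + 1 : ℕ) : ℝ) *
    (if n / q + (j - 1) * (q - 1) + 1 ≤ (i : ℕ) + 1 ∧ (i : ℕ) + 1 ≤ n / q + j * (q - 1)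
      then 1 else 0)

/-- The Hermitian part of `sigma'`. -/
noncomputable def sigmaQuad (q j : ℕ) (w : EuclideanSpace ℂ (Fin n)) : ℝ :=
  ∑ i, quadCoeff n q j i * ‖w i‖ ^ 2

/-- The real part of the polarization of `sigmaQuad`. -/
noncomputable def sigmaPolar (q j : ℕ) (z w : EuclideanSpace ℂ (Fin n)) : ℝ :=
  ∑ i, quadCoeff n q j i * inner ℝ (z i) (w i)

/-- The derivative of `sigma'` at `z` in the direction `w`. -/
noncomputable def sigmaLin (q j : ℕ) (z w : EuclideanSpace ℂ (Fin n)) : ℝ :=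
  imCoord j w + 2 * sigmaPolar q j z w

theorem sigma'_eq (q j : ℕ) (z : EuclideanSpace ℂ (Fin n)) :
    sigma' n q j z = imCoord j z + sigmaQuad q j z := by
  simp only [sigma', imCoord, sigmaQuad, quadCoeff, sub_mul, mul_assoc, sum_sub_distrib,
    ite_mul, one_mul, zero_mul, ← mul_sum]
  ring

theorem norm_add_smul_sq {F : Type*} [NormedAddCommGroup F] [InnerProductSpace ℝ F] (z w : F)
    (t : ℝ) : ‖z + t • w‖ ^ 2 = ‖z‖ ^ 2 + 2 * inner ℝ z w * t + ‖w‖ ^ 2 * t ^ 2 := by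
  rw [norm_add_sq_real, inner_smul_right, norm_smul, mul_pow, Real.norm_eq_abs, sq_abs]
  ring

theorem sigma'_line (q j : ℕ) (z w : EuclideanSpace ℂ (Fin n)) (t : ℝ) :
    sigma' n q j (z + t • w) =
      sigma' n q j z + sigmaLin q j z w * t + sigmaQuad q j w * t ^ 2 := by
  have him : imCoord j (z + t • w) = imCoord j z + imCoord j w * t := by
    simp only [imCoord, sum_mul, ← sum_add_distrib]
    refine sum_congr rfl fun i _ => ?_
    split_ifs <;> simp [mul_comm]
  have hquad : sigmaQuad q j (z + t • w) =
      sigmaQuad q j z + 2 * sigmaPolar q j z w * t + sigmaQuad q j w * t ^ 2 := by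
    simp only [sigmaQuad, sigmaPolar, mul_sum, sum_mul, ← sum_add_distrib]
    refine sum_congr rfl fun i _ => ?_
    rw [PiLp.add_apply, PiLp.smul_apply, norm_add_smul_sq]
    ring
  rw [sigma'_eq, sigma'_eq, him, hquad, sigmaLin]
  ring

theorem contDiff_sigma' (q j : ℕ) : ContDiff ℝ 2 (sigma' n q j) := by
  have hproj : ∀ i : Fin n, ContDiff ℝ 2 fun z : EuclideanSpace ℂ (Fin n) => z i := fun i =>
    ((EuclideanSpace.proj i : EuclideanSpace ℂ (Fin n) →L[ℂ] ℂ).restrictScalars ℝ).contDiff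
  have : sigma' n q j = fun z => imCoord j z + sigmaQuad q j z := funext (sigma'_eq q j)
  rw [this]
  refine ContDiff.add (ContDiff.sum fun i _ => ?_) (ContDiff.sum fun i _ => ?_)
  · split_ifs
    · exact Complex.imCLM.contDiff.comp (hproj i)
    · exact contDiff_const
  · exact contDiff_const.mul ((hproj i).norm_sq ℝ)

theorem contDiff_phi (q : ℕ) (N : ℝ) (j : ℕ) : ContDiff ℝ 2 (phi n q N j) := by
  have hnorm : ContDiff ℝ 2 fun z : EuclideanSpace ℂ (Fin n) => ‖z‖ ^ 2 := contDiff_norm_sq ℝ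
  have hnorm4 : ContDiff ℝ 2 fun z : EuclideanSpace ℂ (Fin n) => ‖z‖ ^ 4 := by
    simpa only [← pow_mul] using hnorm.pow 2
  refine (((?_ : ContDiff ℝ 2 _).add (ContDiff.sum fun i _ => (contDiff_sigma' q i).pow 2)).sub
    (contDiff_const.mul hnorm)).add (contDiff_const.mul hnorm4)
  split_ifs
  · exact (ContDiff.sum fun i _ => contDiff_sigma' q i).neg
  · exact contDiff_sigma' q j

/-- The Hermitian part of the first summand of `phi`. -/
noncomputable def leadQuad (q j : ℕ) (w : EuclideanSpace ℂ (Fin n)) : ℝ :=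
  if j = n / q + 1 then -∑ i ∈ Icc 1 (n / q), sigmaQuad q i w else sigmaQuad q j w

/-- Half the second derivative of `phi` at `z` in the direction `w`. -/
noncomputable def phiQuad (q : ℕ) (N : ℝ) (j : ℕ) (z w : EuclideanSpace ℂ (Fin n)) : ℝ :=
  leadQuad q j w
    + ∑ i ∈ Icc 1 (n / q), (2 * sigma' n q i z * sigmaQuad q i w + sigmaLin q i z w ^ 2)
    - (1 / 4) * ‖w‖ ^ 2 + N * (2 * ‖z‖ ^ 2 * ‖w‖ ^ 2 + (2 * inner ℝ z w) ^ 2)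

theorem iteratedFDeriv_two_phi (q : ℕ) (N : ℝ) (j : ℕ) (z w : EuclideanSpace ℂ (Fin n)) :
    iteratedFDeriv ℝ 2 (phi n q N j) z ![w, w] = 2 * phiQuad q N j z w := by
  let lead : (ℕ → ℝ) → ℝ := fun s =>
    if j = n / q + 1 then -∑ i ∈ Icc 1 (n / q), s i else s j
  have hlead : ∀ (a b c : ℕ → ℝ) (t : ℝ),
      lead (fun i => a i + b i * t + c i * t ^ 2) = lead a + lead b * t + lead c * t ^ 2 := by
    intro a b c t
    simp only [lead]
    split_ifs
    · simp only [sum_add_distrib, ← sum_mul]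
      ring
    · rfl
  have hsq : ∀ (a b c : ℕ → ℝ) (t : ℝ),
      ∑ i ∈ Icc 1 (n / q), (a i + b i * t + c i * t ^ 2) ^ 2 =
        ∑ i ∈ Icc 1 (n / q), a i ^ 2 + (∑ i ∈ Icc 1 (n / q), 2 * a i * b i) * t
          + (∑ i ∈ Icc 1 (n / q), (2 * a i * c i + b i ^ 2)) * t ^ 2
          + (∑ i ∈ Icc 1 (n / q), 2 * b i * c i) * t ^ 3
          + (∑ i ∈ Icc 1 (n / q), c i ^ 2) * t ^ 4 := by
    intro a b c t
    simp only [sum_mul, ← sum_add_distrib]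
    exact sum_congr rfl fun i _ => by ring
  have hphi : ∀ t : ℝ, phi n q N j (z + t • w) =
      lead (fun i => sigma' n q i (z + t • w))
        + ∑ i ∈ Icc 1 (n / q), sigma' n q i (z + t • w) ^ 2
        - (1 / 4) * ‖z + t • w‖ ^ 2 + N * (‖z + t • w‖ ^ 2) ^ 2 := fun t => by
    rw [← pow_mul]; rfl
  refine iteratedFDeriv_two_eq_of_line_eq (contDiff_phi q N j)
    (a₀ := lead (fun i => sigma' n q i z) + ∑ i ∈ Icc 1 (n / q), sigma' n q i z ^ 2
      - (1 / 4) * ‖z‖ ^ 2 + N * (‖z‖ ^ 2) ^ 2)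
    (a₁ := lead (fun i => sigmaLin q i z w)
      + ∑ i ∈ Icc 1 (n / q), 2 * sigma' n q i z * sigmaLin q i z w
      - (1 / 4) * (2 * inner ℝ z w) + N * (2 * ‖z‖ ^ 2 * (2 * inner ℝ z w)))
    (a₃ := ∑ i ∈ Icc 1 (n / q), 2 * sigmaLin q i z w * sigmaQuad q i w
      + N * (2 * (2 * inner ℝ z w) * ‖w‖ ^ 2))
    (a₄ := ∑ i ∈ Icc 1 (n / q), sigmaQuad q i w ^ 2 + N * (‖w‖ ^ 2) ^ 2) fun t => ?_
  have hleadQuad : lead (fun i => sigmaQuad q i w) = leadQuad q j w := rfl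
  simp only [hphi, sigma'_line, norm_add_smul_sq, hlead, hsq, hleadQuad, phiQuad]
  ring

theorem sum_ite_succ_eq_sq (j : ℕ) (g : Fin n → ℝ) :
    (∑ i : Fin n, if (i : ℕ) + 1 = j then g i else 0) ^ 2 =
      ∑ i : Fin n, if (i : ℕ) + 1 = j then g i ^ 2 else 0 := by
  by_cases h : ∃ k : Fin n, (k : ℕ) + 1 = j
  · obtain ⟨k, rfl⟩ := h
    simp [← Fin.ext_iff]
  · push Not at h
    simp [h]

theorem imCoord_sq_add (j : ℕ) (w : EuclideanSpace ℂ (Fin n)) :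
    imCoord j w ^ 2 + imCoord j (Complex.I • w) ^ 2 =
      ∑ i : Fin n, if (i : ℕ) + 1 = j then ‖w i‖ ^ 2 else 0 := by
  rw [imCoord, imCoord, sum_ite_succ_eq_sq, sum_ite_succ_eq_sq, ← sum_add_distrib]
  refine sum_congr rfl fun i _ => ?_
  split_ifs
  · simp only [PiLp.smul_apply, smul_eq_mul, Complex.I_mul_im, Complex.sq_norm,
      Complex.normSq_apply]
    ring
  · simp

theorem abs_imCoord_le (j : ℕ) (w : EuclideanSpace ℂ (Fin n)) : |imCoord j w| ≤ ‖w‖ := by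
  refine abs_le_of_sq_le_sq ?_ (norm_nonneg w)
  have h := imCoord_sq_add j w
  have hle : (∑ i : Fin n, if (i : ℕ) + 1 = j then ‖w i‖ ^ 2 else 0) ≤ ‖w‖ ^ 2 := by
    rw [EuclideanSpace.norm_sq_eq]
    refine sum_le_sum fun i _ => ?_
    split_ifs
    · rfl
    · positivity
  nlinarith [sq_nonneg (imCoord j (Complex.I • w))]

theorem sum_imCoord_sq_add (m : ℕ) (w : EuclideanSpace ℂ (Fin n)) :
    ∑ j ∈ Icc 1 m, (imCoord j w ^ 2 + imCoord j (Complex.I • w) ^ 2) =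
      ∑ i : Fin n, if (i : ℕ) < m then ‖w i‖ ^ 2 else 0 := by
  simp only [imCoord_sq_add]
  rw [sum_comm]
  refine sum_congr rfl fun i _ => ?_
  simp

theorem abs_quadCoeff_le (q j : ℕ) (i : Fin n) : |quadCoeff n q j i| ≤ (n / q : ℕ) + 2 := by
  have hm : (0 : ℝ) ≤ (n / q : ℕ) := Nat.cast_nonneg _
  rw [quadCoeff, abs_le]
  push_cast only [Nat.cast_add, Nat.cast_one]
  constructor <;> split_ifs <;> linarith

theorem abs_sigmaPolar_le (q j : ℕ) (z w : EuclideanSpace ℂ (Fin n)) :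
    |sigmaPolar q j z w| ≤ ((n / q : ℕ) + 2) * (‖z‖ * ‖w‖) := by
  have hcs : ∑ i, ‖z i‖ * ‖w i‖ ≤ ‖z‖ * ‖w‖ := by
    simpa only [EuclideanSpace.norm_eq] using
      Real.sum_mul_le_sqrt_mul_sqrt univ (fun i => ‖z i‖) (fun i => ‖w i‖)
  calc |sigmaPolar q j z w| ≤ ∑ i, |quadCoeff n q j i * inner ℝ (z i) (w i)| :=
        abs_sum_le_sum_abs _ _
    _ ≤ ∑ i, ((n / q : ℕ) + 2) * (‖z i‖ * ‖w i‖) := by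
        refine sum_le_sum fun i _ => ?_
        rw [abs_mul]
        exact mul_le_mul (abs_quadCoeff_le q j i) (abs_real_inner_le_norm _ _) (abs_nonneg _)
          (by positivity)
    _ ≤ _ := by
        rw [← mul_sum]
        gcongr

theorem sigmaPolar_self (q j : ℕ) (w : EuclideanSpace ℂ (Fin n)) :
    sigmaPolar q j w w = sigmaQuad q j w := by
  simp only [sigmaPolar, sigmaQuad, real_inner_self_eq_norm_sq]

theorem abs_sigmaQuad_le (q j : ℕ) (w : EuclideanSpace ℂ (Fin n)) :
    |sigmaQuad q j w| ≤ ((n / q : ℕ) + 2) * ‖w‖ ^ 2 := by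
  simpa only [sigmaPolar_self, ← sq] using abs_sigmaPolar_le q j w w

theorem abs_sigma'_le (q j : ℕ) (z : EuclideanSpace ℂ (Fin n)) :
    |sigma' n q j z| ≤ ‖z‖ + ((n / q : ℕ) + 2) * ‖z‖ ^ 2 := by
  rw [sigma'_eq]
  exact (abs_add_le _ _).trans (add_le_add (abs_imCoord_le j z) (abs_sigmaQuad_le q j z))

theorem sigmaQuad_I_smul (q j : ℕ) (w : EuclideanSpace ℂ (Fin n)) :
    sigmaQuad q j (Complex.I • w) = sigmaQuad q j w := by
  simp [sigmaQuad]

theorem leadQuad_I_smul (q j : ℕ) (w : EuclideanSpace ℂ (Fin n)) :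
    leadQuad q j (Complex.I • w) = leadQuad q j w := by
  simp only [leadQuad, sigmaQuad_I_smul]

theorem le_sigmaLin_sq (q j : ℕ) (z w : EuclideanSpace ℂ (Fin n)) :
    3 / 4 * imCoord j w ^ 2 - 12 * ((n / q : ℕ) + 2) ^ 2 * (‖z‖ ^ 2 * ‖w‖ ^ 2) ≤
      sigmaLin q j z w ^ 2 := by
  have h := sq_le_sq' (abs_le.1 (abs_sigmaPolar_le q j z w)).1
    (abs_le.1 (abs_sigmaPolar_le q j z w)).2
  rw [sigmaLin]
  nlinarith [sq_nonneg (imCoord j w + 8 * sigmaPolar q j z w)]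

/-- If the Hermitian part of the first summand of `phi` dominates the squared norms of the
coordinates beyond the first `n / q`, then `phi` has positive Levi form. -/
theorem phiQuad_add_pos {q : ℕ} {N : ℝ} {j : ℕ} {z w : EuclideanSpace ℂ (Fin n)}
    (hN : (8 * (n / q : ℕ) ^ 2 + 7 * (n / q : ℕ)) * ((n / q : ℕ) + 2 : ℝ) ^ 2 ≤ N) (hw : w ≠ 0)
    (hlead : ∑ i : Fin n, (if (i : ℕ) < n / q then 0 else ‖w i‖ ^ 2) ≤ leadQuad q j w) :
    0 < phiQuad q N j z w + phiQuad q N j z (Complex.I • w) := by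
  have hterm : ∀ i ∈ Icc 1 (n / q),
      3 / 4 * (imCoord i w ^ 2 + imCoord i (Complex.I • w) ^ 2)
        - (4 * ((n / q : ℕ) + 2) * ‖z‖ + 28 * ((n / q : ℕ) + 2) ^ 2 * ‖z‖ ^ 2) * ‖w‖ ^ 2 ≤
      (2 * sigma' n q i z * sigmaQuad q i w + sigmaLin q i z w ^ 2) +
        (2 * sigma' n q i z * sigmaQuad q i w + sigmaLin q i z (Complex.I • w) ^ 2) := by
    intro i _
    have h₁ := le_sigmaLin_sq q i z w
    have h₂ := le_sigmaLin_sq q i z (Complex.I • w)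
    rw [norm_smul, Complex.norm_I, one_mul] at h₂
    have h₃ : |sigma' n q i z * sigmaQuad q i w| ≤
        (‖z‖ + ((n / q : ℕ) + 2) * ‖z‖ ^ 2) * (((n / q : ℕ) + 2) * ‖w‖ ^ 2) := by
      rw [abs_mul]
      exact mul_le_mul (abs_sigma'_le q i z) (abs_sigmaQuad_le q i w) (abs_nonneg _)
        (by positivity)
    linarith [(abs_le.1 h₃).1]
  have hsum := sum_le_sum hterm
  rw [sum_sub_distrib, sum_add_distrib, ← mul_sum, sum_imCoord_sq_add, sum_const, Nat.card_Icc,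
    Nat.add_sub_cancel, nsmul_eq_mul] at hsum
  have hnorm : ‖w‖ ^ 2 = ∑ i : Fin n, (if (i : ℕ) < n / q then ‖w i‖ ^ 2 else 0)
      + ∑ i : Fin n, (if (i : ℕ) < n / q then 0 else ‖w i‖ ^ 2) := by
    rw [EuclideanSpace.norm_sq_eq, ← sum_add_distrib]
    refine sum_congr rfl fun i _ => ?_
    split_ifs <;> simp
  have htail : 0 ≤ ∑ i : Fin n, (if (i : ℕ) < n / q then 0 else ‖w i‖ ^ 2) :=
    sum_nonneg fun i _ => by split_ifs <;> positivity
  have hw' : 0 < ‖w‖ ^ 2 := by positivity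
  simp only [phiQuad, leadQuad_I_smul, sigmaQuad_I_smul, norm_smul, Complex.norm_I, one_mul]
  set m : ℝ := ((n / q : ℕ) : ℝ)
  have hm : 0 ≤ m := Nat.cast_nonneg _
  have hN₀ : 0 ≤ N := le_trans (by positivity) hN
  have hN' := mul_le_mul_of_nonneg_right hN (by positivity : 0 ≤ ‖z‖ ^ 2 * ‖w‖ ^ 2)
  have hyoung := mul_nonneg (sq_nonneg (16 * m * (m + 2) * ‖z‖ - 1)) hw'.le
  have hs₁ := mul_nonneg hN₀ (sq_nonneg (2 * inner ℝ z w))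
  have hs₂ := mul_nonneg hN₀ (sq_nonneg (2 * inner ℝ z (Complex.I • w)))
  linarith

theorem one_le_neg_sum_quadCoeff {q : ℕ} (hq : 2 ≤ q) (i : Fin n) (hi : n / q ≤ (i : ℕ))
    (hi' : (i : ℕ) < n / q * q) : 1 ≤ -∑ j ∈ Icc 1 (n / q), quadCoeff n q j i := by
  set m := n / q with hm
  obtain ⟨p, rfl⟩ : ∃ p, q = p + 2 := ⟨q - 2, by omega⟩
  obtain ⟨k, hk⟩ := Nat.exists_eq_add_of_le hi
  have hdiv := Nat.div_add_mod k (p + 1)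
  have hmod : k % (p + 1) < p + 1 := Nat.mod_lt k (Nat.succ_pos p)
  set d := k / (p + 1)
  have hd : d < m := by
    rw [Nat.div_lt_iff_lt_mul (Nat.succ_pos p)]
    nlinarith
  have hmem : d + 1 ∈ Icc 1 m := by simp; omega
  have hone : (1 : ℝ) ≤ ∑ j ∈ Icc 1 m,
      (if m + (j - 1) * (p + 2 - 1) + 1 ≤ (i : ℕ) + 1 ∧ (i : ℕ) + 1 ≤ m + j * (p + 2 - 1)
        then 1 else 0) := by
    refine le_trans ?_ (single_le_sum (fun j _ => ?_) hmem)
    · rw [if_pos]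
      simp only [Nat.add_sub_cancel, show p + 2 - 1 = p + 1 by omega]
      have hcomm : (d + 1) * (p + 1) = (p + 1) * d + (p + 1) := by ring
      have hcomm' : d * (p + 1) = (p + 1) * d := mul_comm _ _
      omega
    · split_ifs <;> norm_num
  simp only [quadCoeff, ← hm, sum_sub_distrib, ← mul_sum]
  rw [if_pos (by omega), sum_const, Nat.card_Icc, Nat.add_sub_cancel, nsmul_eq_mul]
  rw [Nat.cast_add, Nat.cast_one]
  nlinarith [(Nat.cast_nonneg m : (0 : ℝ) ≤ m)]

theorem quadCoeff_of_lt {q j : ℕ} {i : Fin n} (hi : (i : ℕ) < n / q) :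
    quadCoeff n q j i = 0 := by
  rw [quadCoeff, if_neg (by omega), if_neg (by omega)]
  simp

theorem le_leadQuad_of_mem_block {q j : ℕ} (hj : j ≤ n / q) (hj₁ : 1 ≤ j)
    {w : EuclideanSpace ℂ (Fin n)}
    (hw : w ∈ vanishingOn n (n / q + (j - 1) * (q - 1)) (q - 1)) :
    ∑ i : Fin n, (if (i : ℕ) < n / q then 0 else ‖w i‖ ^ 2) ≤ leadQuad q j w := by
  rw [leadQuad, if_neg (by omega), sigmaQuad]
  refine sum_le_sum fun i _ => ?_
  split_ifs with hi
  · simp [quadCoeff_of_lt hi]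
  · obtain ⟨k, rfl⟩ := Nat.exists_eq_add_of_le' hj₁
    rw [quadCoeff, if_pos (by omega)]
    split_ifs with hblock
    · rw [hw i (by omega) (by
        have := Nat.add_mul k 1 (q - 1)
        rw [Nat.add_sub_cancel]
        omega)]
      simp
    · simp

theorem le_leadQuad_of_mem_tail {q : ℕ} (hq : 2 ≤ q) {w : EuclideanSpace ℂ (Fin n)}
    (hw : w ∈ vanishingOn n (n / q * q) (q - 1)) :
    ∑ i : Fin n, (if (i : ℕ) < n / q then 0 else ‖w i‖ ^ 2) ≤ leadQuad q (n / q + 1) w := by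
  simp only [leadQuad, if_true, sigmaQuad]
  rw [sum_comm, ← sum_neg_distrib]
  refine sum_le_sum fun i _ => ?_
  rw [← sum_mul, ← neg_mul]
  split_ifs with hi
  · simp [quadCoeff_of_lt hi]
  · rcases lt_or_ge (i : ℕ) (n / q * q) with hlt | hge
    · exact le_mul_of_one_le_left (by positivity) (one_le_neg_sum_quadCoeff hq i (not_lt.1 hi) hlt)
    · have hdiv := Nat.div_add_mod' n q
      have hmod := Nat.mod_lt n (by omega : 0 < q)
      rw [hw i hge (by omega)]
      simp

end

/-- there exists N₀ > 0 such that for every N ≥ N₀ and every j ∈ {1,…,m+1},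
φⱼ is q-convex on ℂⁿ: for every z there is a complex-linear subspace V of ℂⁿ with
dim_ℂ V ≥ n − q + 1 such that for every nonzero w ∈ V the Levi form of φⱼ at z is positive
on w, i.e. D²φⱼ(z)(w,w) + D²φⱼ(z)(i·w, i·w) > 0, where D²φⱼ(z) is the second real Fréchet
derivative of φⱼ at z. -/
theorem stmt9 (n q : ℕ) (hn : 4 ≤ n) (hq1 : 1 ≤ q) (hqn : q ≤ n) (hdvd : ¬ q ∣ n) :
    ∃ N₀ : ℝ, 0 < N₀ ∧
      ∀ N : ℝ, N₀ ≤ N → ∀ j : ℕ, 1 ≤ j → j ≤ n / q + 1 →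
        ∀ z : EuclideanSpace ℂ (Fin n),
          ∃ V : Submodule ℂ (EuclideanSpace ℂ (Fin n)),
            n - q + 1 ≤ Module.finrank ℂ V ∧
            ∀ w ∈ V, w ≠ 0 →
              0 < iteratedFDeriv ℝ 2 (phi n q N j) z ![w, w]
                  + iteratedFDeriv ℝ 2 (phi n q N j) z
                      ![Complex.I • w, Complex.I • w] := by
  have hq2 : 2 ≤ q := by
    rcases hq1.eq_or_lt with rfl | h
    · exact absurd (one_dvd n) hdvd
    · exact h
  refine ⟨(8 * (n / q : ℕ) ^ 2 + 7 * (n / q : ℕ)) * ((n / q : ℕ) + 2 : ℝ) ^ 2 + 1, by positivity,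
    fun N hN j hj₁ hj z => ?_⟩
  have hpos : ∀ w, w ≠ 0 →
      ∑ i : Fin n, (if (i : ℕ) < n / q then 0 else ‖w i‖ ^ 2) ≤ leadQuad q j w →
      0 < iteratedFDeriv ℝ 2 (phi n q N j) z ![w, w]
        + iteratedFDeriv ℝ 2 (phi n q N j) z ![Complex.I • w, Complex.I • w] := by
    intro w hw hlead
    rw [iteratedFDeriv_two_phi, iteratedFDeriv_two_phi]
    linarith [phiQuad_add_pos (z := z) (by linarith : _ ≤ N) hw hlead]
  rcases hj.lt_or_eq with hlt | rfl
  · have hrank := le_finrank_vanishingOn n (n / q + (j - 1) * (q - 1)) (q - 1)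
    exact ⟨_, by omega, fun w hwV hw =>
      hpos w hw (le_leadQuad_of_mem_block (Nat.lt_succ_iff.1 hlt) hj₁ hwV)⟩
  · have hrank := le_finrank_vanishingOn n (n / q * q) (q - 1)
    exact ⟨_, by omega, fun w hwV hw => hpos w hw (le_leadQuad_of_mem_tail hq2 hwV)⟩
end
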